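/- (Power series expansion.) Assume g and h are affine: g(u) = δ₁u + δ₂, h(v) = ρ₁v + ρ₂ with δ₁, ρ₁ > 0, and let f ∈ _{RL}SM^{(α,β)}_{(g,h)}(S_{a,b,c}). Let I ∈ 𝕊, z₀ = u₀ + Iv₀ ∈ ℂ_I and ρ > 0 be such that the closed disc {z ∈ ℂ_I : |z − z₀| ≤ ρ} is contained in S_{a,b,c,I}. Then there exists a sequence (C_m)_{m ≥ 0} of elements of ℝ_n such that F_I(z) = Σ_{m=0}^∞ (z − z₀)^m C_m, the series converging, for every z ∈ ℂ_I with |z − z₀| < ρ, where F_I(u + Iv) := (1/δ₁) A_I(u) + (1/ρ₁) B_I(v). -/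

import Mathlib

open scoped BigOperators
open Set

noncomputable section

/-- The sphere 𝕊 of (coefficient vectors of) unit 1-vectors in ℝⁿ. -/
def USphere (n : ℕ) : Set (Fin n → ℝ) := {x | ∑ i, x i ^ 2 = 1}

/-- Points of ℝ^{n+1}, written as (x₀, (x₁, …, xₙ)). -/
abbrev Pt (n : ℕ) := ℝ × (Fin n → ℝ)

variable {n : ℕ} {Cl : Type} [NormedRing Cl] [NormedAlgebra ℝ Cl]

/-- The 1-vector of the Clifford algebra with coefficients `x` w.r.t. generators `e`. -/
def vecEmb (e : Fin n → Cl) (x : Fin n → ℝ) : Cl := ∑ i, x i • e i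

/-- The defining relations `eᵢeⱼ + eⱼeᵢ = -2δᵢⱼ` of the Clifford algebra ℝₙ. -/
def CliffordRel (e : Fin n → Cl) : Prop :=
  ∀ i j, e i * e j + e j * e i = if i = j then (-2 : Cl) else 0

/-- The slice Cauchy–Riemann operator `(∂/∂u + I ∂/∂v)` applied to the restriction of `f`
to the slice `ℂ_I`, `I = vecEmb e x`, evaluated at the point `u + I v`. -/
def sliceCR (e : Fin n → Cl) (f : Pt n → Cl) (x : Fin n → ℝ) (u v : ℝ) : Cl :=
  deriv (fun t => f (t, v • x)) u + vecEmb e x * deriv (fun t => f (u, t • x)) v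

/-- λ-slice monogenic functions on `U`. -/
def SMlam (e : Fin n → Cl) (lam : ℝ) (U : Set (Pt n)) (f : Pt n → Cl) : Prop :=
  ContDiffOn ℝ 1 f U ∧
  ∀ x ∈ USphere n, ∀ u v : ℝ, ((u, v • x) : Pt n) ∈ U →
    sliceCR e f x u v + lam • f (u, v • x) = 0

/-- The coordinates (u,v) of the slice `U_I = U ∩ ℂ_I`, `I = vecEmb e x`. -/
def SlicePre (n : ℕ) (U : Set (Pt n)) (x : Fin n → ℝ) : Set (ℝ × ℝ) :=
  {p | ((p.1, p.2 • x) : Pt n) ∈ U}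

/-- Axially symmetric slice domains in ℝ^{n+1}. -/
def AxSymSDomain (n : ℕ) (U : Set (Pt n)) : Prop :=
  IsOpen U ∧ IsConnected U ∧ (∃ u : ℝ, ((u, (0 : Fin n → ℝ)) : Pt n) ∈ U) ∧
  (∀ x ∈ USphere n, IsConnected (SlicePre n U x)) ∧
  ∀ x ∈ USphere n, ∀ y ∈ USphere n, ∀ u v : ℝ,
    ((u, v • x) : Pt n) ∈ U → ((u, v • y) : Pt n) ∈ U

/-- A holomorphic function with values in `ℂ_I`, `I = vecEmb e x`, on a
(relatively open) coordinate set `V`. -/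
def SliceHolo (e : Fin n → Cl) (x : Fin n → ℝ) (V : Set (ℝ × ℝ)) (F : ℝ × ℝ → Cl) : Prop :=
  DifferentiableOn ℝ F V ∧
  (∀ p ∈ V, ∃ a b : ℝ, F p = algebraMap ℝ Cl a + b • vecEmb e x) ∧
  ∀ p ∈ V, deriv (fun t => F (t, p.2)) p.1 + vecEmb e x * deriv (fun t => F (p.1, t)) p.2 = 0

/-- Ordered product `I_A = I_{i₁} ⋯ I_{i_k}` over a finite index set `A`. -/
def IAprod (e : Fin n → Cl) (J : Fin n → Fin n → ℝ) (A : Finset (Fin n)) : Cl :=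
  ((A.sort (· ≤ ·)).map fun i => vecEmb e (J i)).prod

/-- A closed piecewise-C¹ curve parametrized on [0,1]. -/
def PiecewiseC1 (γ : ℝ → ℝ × ℝ) : Prop :=
  ContinuousOn γ (Icc 0 1) ∧
  ∃ (k : ℕ) (t : Fin (k + 1) → ℝ), t 0 = 0 ∧ t (Fin.last k) = 1 ∧ StrictMono t ∧
    ∀ i : Fin k, ContDiffOn ℝ 1 γ (Icc (t i.castSucc) (t i.succ))

/-- `γ` is a closed curve in `V`, homotopic within `V` to a constant curve. -/
def NullHomotopicIn (γ : ℝ → ℝ × ℝ) (V : Set (ℝ × ℝ)) : Prop :=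
  γ 0 = γ 1 ∧ (∀ t ∈ Icc (0:ℝ) 1, γ t ∈ V) ∧
  ∃ (H : ℝ × ℝ → ℝ × ℝ) (p : ℝ × ℝ),
    ContinuousOn H (Icc 0 1 ×ˢ Icc 0 1) ∧
    (∀ q ∈ (Icc (0:ℝ) 1 ×ˢ Icc (0:ℝ) 1), H q ∈ V) ∧
    (∀ t ∈ Icc (0:ℝ) 1, H (0, t) = γ t) ∧
    (∀ t ∈ Icc (0:ℝ) 1, H (1, t) = p) ∧
    (∀ s ∈ Icc (0:ℝ) 1, H (s, 0) = H (s, 1))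

/-- The inverse `(a + bI)⁻¹` computed in the field `ℂ_I`, `I = vecEmb e x`. -/
def sliceInv (e : Fin n → Cl) (x : Fin n → ℝ) (a b : ℝ) : Cl :=
  (a ^ 2 + b ^ 2)⁻¹ • (algebraMap ℝ Cl a - b • vecEmb e x)

/-- The closed Euclidean ball of ℝ^{n+1}. -/
def EucClosedBall (y : Pt n) (ρ : ℝ) : Set (Pt n) :=
  {p | (p.1 - y.1) ^ 2 + ∑ i, (p.2 i - y.2 i) ^ 2 ≤ ρ ^ 2}

/-- Left fractional integral of order `σ` with respect to `g` (with derivative `g'`),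
with base point `aa`. -/
def fracInt (aa σ : ℝ) (g g' : ℝ → ℝ) (φ : ℝ → Cl) (u : ℝ) : Cl :=
  (Real.Gamma σ)⁻¹ • ∫ τ in aa..u, ((g u - g τ) ^ (σ - 1) * g' τ) • φ τ

/-- Right fractional integral of order `σ` with respect to `h` (with derivative `h'`),
with base point `cc`. -/
def fracIntR (cc σ : ℝ) (h h' : ℝ → ℝ) (φ : ℝ → Cl) (v : ℝ) : Cl :=
  (Real.Gamma σ)⁻¹ • ∫ τ in v..cc, ((h τ - h v) ^ (σ - 1) * h' τ) • φ τ

/-- Left Riemann–Liouville fractional derivative of order `al` w.r.t. `g` on `[aa, bb]`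
(one-sided derivatives at the endpoints). -/
def rlD (aa bb al : ℝ) (g g' : ℝ → ℝ) (φ : ℝ → Cl) (u : ℝ) : Cl :=
  (g' u)⁻¹ • derivWithin (fracInt aa (1 - al) g g' φ) (Icc aa bb) u

/-- The set `S_{a,b,c} ⊆ ℝ^{n+1}`. -/
def Sabc (n : ℕ) (a b c : ℝ) : Set (Pt n) :=
  {p | ∃ x ∈ USphere n, ∃ u ∈ Icc a b, ∃ v ∈ Icc 0 c, p = ((u, v • x) : Pt n)}

/-- Absolutely continuous function on `[a,b]`. -/
def AbsContOn {E : Type} [NormedAddCommGroup E] (φ : ℝ → E) (a b : ℝ) : Prop :=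
  ∀ ε > (0:ℝ), ∃ δ > (0:ℝ), ∀ (k : ℕ) (p q : Fin k → ℝ),
    (∀ i, p i ∈ Icc a b ∧ q i ∈ Icc a b ∧ p i ≤ q i) →
    (∀ i j, i ≠ j → Ioo (p i) (q i) ∩ Ioo (p j) (q j) = ∅) →
    (∑ i, (q i - p i)) < δ → (∑ i, ‖φ (q i) - φ (p i)‖) < ε

/-- The class `AC¹(S_{a,b,c}, ℝₙ)`. -/
def AC1 (a b c r s : ℝ) (f : Pt n → Cl) : Prop :=
  ContinuousOn f (Sabc n a b c) ∧
  ∀ x ∈ USphere n,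
    AbsContOn (fun u => f (u, s • x)) a b ∧ AbsContOn (fun v => f (r, v • x)) 0 c

/-- `A_I(u) = (I_{a+}^{1-α,g}[τ ↦ f(τ + Is)])(u)`, where `I = vecEmb e x`. -/
def AIfun (a al s : ℝ) (g g' : ℝ → ℝ) (f : Pt n → Cl) (x : Fin n → ℝ) : ℝ → Cl :=
  fracInt a (1 - al) g g' fun τ => f (τ, s • x)

/-- `B_I(v) = (I_{0+}^{1-β,h}[τ ↦ f(r + Iτ)])(v)`, where `I = vecEmb e x`. -/
def BIfun (be r : ℝ) (h h' : ℝ → ℝ) (f : Pt n → Cl) (x : Fin n → ℝ) : ℝ → Cl :=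
  fracInt 0 (1 - be) h h' fun τ => f (r, τ • x)

/-- `B_I^{c-}(v) = (I_{c-}^{1-β,h}[τ ↦ f(r + Iτ)])(v)`, where `I = vecEmb e x`. -/
def BIcfun (c be r : ℝ) (h h' : ℝ → ℝ) (f : Pt n → Cl) (x : Fin n → ℝ) : ℝ → Cl :=
  fracIntR c (1 - be) h h' fun τ => f (r, τ • x)

/-- Condition (m1): the maps `A_I` and `B_I` are of class C¹ for every `I ∈ 𝕊`. -/
def M1 (a b c al be r s : ℝ) (g g' h h' : ℝ → ℝ) (f : Pt n → Cl) : Prop :=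
  ∀ x ∈ USphere n,
    ContDiffOn ℝ 1 (AIfun a al s g g' f x) (Icc a b) ∧
    ContDiffOn ℝ 1 (BIfun be r h h' f x) (Icc 0 c)

/-- Riemann–Liouville fractional slice monogenic functions of order `(α,β)`
with respect to `(g,h)` on `S_{a,b,c}`. -/
def RLSM (a b c al be r s : ℝ) (g g' h h' : ℝ → ℝ) (e : Fin n → Cl) (f : Pt n → Cl) : Prop :=
  AC1 a b c r s f ∧ M1 a b c al be r s g g' h h' f ∧
  ∀ x ∈ USphere n, ∀ u ∈ Icc a b, ∀ v ∈ Icc 0 c,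
    (g' u)⁻¹ • derivWithin (AIfun a al s g g' f x) (Icc a b) u +
      vecEmb e x * ((h' v)⁻¹ • derivWithin (BIfun be r h h' f x) (Icc 0 c) v) = 0


theorem vecEmb_mul_self {e : Fin n → Cl} (he : CliffordRel e) {x : Fin n → ℝ}
    (hx : x ∈ USphere n) : vecEmb e x * vecEmb e x = -1 := by
  have expand : vecEmb e x * vecEmb e x = ∑ i, ∑ j, (x i * x j) • (e i * e j) := by
    simp only [vecEmb, Finset.sum_mul_sum, smul_mul_smul_comm]
  have swap : vecEmb e x * vecEmb e x = ∑ i, ∑ j, (x i * x j) • (e j * e i) := by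
    rw [expand, Finset.sum_comm]
    simp only [mul_comm (x _) (x _)]
  have double : (2 : ℝ) • (vecEmb e x * vecEmb e x) = (2 : ℝ) • (-1 : Cl) := by
    rw [two_smul]
    nth_rewrite 1 [expand]
    rw [swap]
    simp only [← Finset.sum_add_distrib, ← smul_add, he _ _, smul_ite, smul_zero,
      Finset.sum_ite_eq, Finset.mem_univ, if_true, ← Finset.sum_smul, ← pow_two]
    rw [show ∑ i, x i ^ 2 = 1 from hx, one_smul, two_smul]
    norm_num
  exact smul_right_injective Cl (two_ne_zero' ℝ) double

theorem sub_eq_smul_of_derivWithin_Icc_eq {E : Type*} [NormedAddCommGroup E] [NormedSpace ℝ E]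
    {φ : ℝ → E} {a b : ℝ} {D : E} (hφ : DifferentiableOn ℝ φ (Icc a b))
    (hD : ∀ t ∈ Icc a b, derivWithin φ (Icc a b) t = D) {t t₀ : ℝ}
    (ht : t ∈ Icc a b) (ht₀ : t₀ ∈ Icc a b) : φ t - φ t₀ = (t - t₀) • D := by
  have hder : ∀ y ∈ Icc a b,
      HasDerivWithinAt (fun y => φ y - y • D) 0 (Icc a b) y := fun y hy => by
    have h := (hφ y hy).hasDerivWithinAt.sub
      ((hasDerivWithinAt_id y (Icc a b)).smul_const D)
    rw [hD y hy, one_smul, sub_self] at h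
    exact h
  have h := (convex_Icc a b).norm_image_sub_le_of_norm_hasDerivWithin_le (C := 0) hder
    (fun _ _ => norm_zero.le) ht₀ ht
  rw [zero_mul, norm_le_zero_iff] at h
  rw [sub_smul, ← sub_eq_zero, ← h]
  abel

/-- Power series expansion of `F_I(u+Iv) = (1/δ₁)A_I(u) + (1/ρ₁)B_I(v)`
for Riemann–Liouville fractional slice monogenic functions, affine `g`, `h`. -/
theorem statement12 [CompleteSpace Cl] (e : Fin n → Cl) (he : CliffordRel e)
    (a b c r s al be δ₁ δ₂ ρ₁ ρ₂ : ℝ)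
    (hab : a < b) (hc : 0 < c) (hr : r ∈ Icc a b) (hs : s ∈ Icc 0 c)
    (hal : al ∈ Ioo (0:ℝ) 1) (hbe : be ∈ Ioo (0:ℝ) 1)
    (hδ : 0 < δ₁) (hρ : 0 < ρ₁)
    (f : Pt n → Cl)
    (hf : RLSM a b c al be r s (fun u => δ₁ * u + δ₂) (fun _ => δ₁)
      (fun v => ρ₁ * v + ρ₂) (fun _ => ρ₁) e f)
    (x : Fin n → ℝ) (hx : x ∈ USphere n)
    (u₀ v₀ ρ : ℝ) (hρ0 : 0 < ρ)
    (hdisc : {p : ℝ × ℝ | (p.1 - u₀) ^ 2 + (p.2 - v₀) ^ 2 ≤ ρ ^ 2}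
      ⊆ (Icc a b ×ˢ Icc 0 c : Set (ℝ × ℝ))) :
    ∃ C : ℕ → Cl, ∀ u v : ℝ, (u - u₀) ^ 2 + (v - v₀) ^ 2 < ρ ^ 2 →
      HasSum (fun m : ℕ => ((u - u₀) • (1 : Cl) + (v - v₀) • vecEmb e x) ^ m * C m)
        (δ₁⁻¹ • AIfun a al s (fun u => δ₁ * u + δ₂) (fun _ => δ₁) f x u
          + ρ₁⁻¹ • BIfun be r (fun v => ρ₁ * v + ρ₂) (fun _ => ρ₁) f x v) := by
  obtain ⟨-, hm1, hCR⟩ := hf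
  obtain ⟨hA, hB⟩ := hm1 x hx
  replace hCR := hCR x hx
  set A := AIfun a al s (fun u => δ₁ * u + δ₂) (fun _ => δ₁) f x
  set B := BIfun be r (fun v => ρ₁ * v + ρ₂) (fun _ => ρ₁) f x
  set J := vecEmb e x
  have hJ : J * J = -1 := vecEmb_mul_self he hx
  obtain ⟨hu₀, hv₀⟩ : u₀ ∈ Icc a b ∧ v₀ ∈ Icc 0 c :=
    hdisc (a := (u₀, v₀)) (by simp [sq_nonneg])
  set K := δ₁⁻¹ • derivWithin A (Icc a b) u₀
  have hdA : ∀ u ∈ Icc a b, derivWithin A (Icc a b) u = δ₁ • K := fun u hu => by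
    have h : δ₁⁻¹ • derivWithin A (Icc a b) u = K :=
      add_right_cancel ((hCR u hu v₀ hv₀).trans (hCR u₀ hu₀ v₀ hv₀).symm)
    rw [← h, smul_inv_smul₀ hδ.ne']
  have hdB : ∀ v ∈ Icc 0 c, derivWithin B (Icc 0 c) v = ρ₁ • (J * K) := fun v hv => by
    have h : K = -(J * (ρ₁⁻¹ • derivWithin B (Icc 0 c) v)) :=
      eq_neg_of_add_eq_zero_left (hCR u₀ hu₀ v hv)
    rw [h, mul_neg, ← mul_assoc, hJ, neg_one_mul, neg_neg, smul_inv_smul₀ hρ.ne']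
  refine ⟨fun m => if m = 0 then δ₁⁻¹ • A u₀ + ρ₁⁻¹ • B v₀ else if m = 1 then K else 0,
    fun u v huv => ?_⟩
  obtain ⟨hu, hv⟩ : u ∈ Icc a b ∧ v ∈ Icc 0 c := hdisc (a := (u, v)) huv.le
  have hAu : A u = A u₀ + (u - u₀) • δ₁ • K := eq_add_of_sub_eq'
    (sub_eq_smul_of_derivWithin_Icc_eq (hA.differentiableOn one_ne_zero) hdA hu hu₀)
  have hBv : B v = B v₀ + (v - v₀) • ρ₁ • (J * K) := eq_add_of_sub_eq'
    (sub_eq_smul_of_derivWithin_Icc_eq (hB.differentiableOn one_ne_zero) hdB hv hv₀)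
  have hsum := hasSum_sum_of_ne_finset_zero (L := .unconditional ℕ)
    (f := fun m : ℕ => ((u - u₀) • (1 : Cl) + (v - v₀) • J) ^ m *
      if m = 0 then δ₁⁻¹ • A u₀ + ρ₁⁻¹ • B v₀ else if m = 1 then K else 0)
    (s := Finset.range 2) fun m hm => by
      rw [Finset.mem_range, not_lt] at hm
      simp [show m ≠ 0 by omega, show m ≠ 1 by omega]
  convert hsum using 1
  simp only [Finset.sum_range_succ, Finset.sum_range_zero, hAu, hBv, smul_add,
    smul_comm δ₁⁻¹ (u - u₀), smul_comm ρ₁⁻¹ (v - v₀),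
    inv_smul_smul₀ hδ.ne', inv_smul_smul₀ hρ.ne']
  simp only [pow_zero, pow_one, one_mul, zero_add, add_mul, smul_mul_assoc, if_true,
    one_ne_zero, if_false]
  abel
end
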